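/- arXiv:1802.09948 — 2 statements merged into one kernel-verified Lean document; each statement's English description precedes it below -/
import Mathlib

section
/- Let p be an odd prime. Write Hol(ℤ/p²ℤ) = ℤ/p²ℤ ⋊ ⟨σ⟩ where σ is a generator of (ℤ/p²ℤ)*. The cyclic subgroups of order p² of Hol(ℤ/p²ℤ) are exactly the p subgroups ⟨(1, σ^{j(p-1)})⟩ for j = 0, 1, ..., p−1. -/
/-- The affine permutation `x ↦ a + u * x` of `ZMod n`. -/
def affinePerm (n : ℕ) (a : ZMod n) (u : (ZMod n)ˣ) : Equiv.Perm (ZMod n) :=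
  (Units.mulLeft u).trans (Equiv.addLeft a)

theorem aff_pow (n : ℕ) (a : ZMod n) (u : (ZMod n)ˣ) (m : ℕ) (x : ZMod n) :
    (affinePerm n a u ^ m) x
      = a * (∑ i ∈ Finset.range m, (u : ZMod n) ^ i) + (u : ZMod n) ^ m * x := by
  induction m generalizing x with
  | zero => simp
  | succ m ih =>
    rw [pow_succ, Equiv.Perm.mul_apply, ih, Finset.sum_range_succ]
    simp only [affinePerm, Equiv.trans_apply, Units.mulLeft_apply, Equiv.coe_addLeft]
    ring

theorem cast_zero_dvd (p : ℕ) (hp : p.Prime) (x : ZMod (p ^ 2))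
    (h : ZMod.castHom (Dvd.intro_left p (by ring : p * p = p ^ 2)) (ZMod p) x = 0) :
    ∃ k : ℕ, x = (p : ZMod (p ^ 2)) * k := by
  have : NeZero (p ^ 2) := ⟨pow_ne_zero _ hp.ne_zero⟩
  obtain ⟨y, rfl⟩ : ∃ y : ℕ, (y : ZMod (p ^ 2)) = x := ⟨x.val, ZMod.natCast_zmod_val x⟩
  rw [map_natCast, ZMod.natCast_eq_zero_iff] at h
  obtain ⟨k, rfl⟩ := h
  exact ⟨k, by push_cast; rfl⟩

theorem psq (p : ℕ) : (p : ZMod (p ^ 2)) * p = 0 := by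
  have := ZMod.natCast_self (p ^ 2)
  push_cast at this
  rw [← this]; ring

theorem unit_form (p : ℕ) (hp : p.Prime) (u : (ZMod (p ^ 2))ˣ) (hu : u ^ p = 1) :
    ∃ k : ℕ, (u : ZMod (p ^ 2)) = 1 + p * k := by
  have := Fact.mk hp
  obtain ⟨k, hk⟩ := cast_zero_dvd p hp ((u : ZMod (p ^ 2)) - 1) (by
    rw [map_sub, map_one, sub_eq_zero]
    rw [← ZMod.pow_card (ZMod.castHom _ (ZMod p) (u : ZMod (p ^ 2))), ← map_pow,
      ← Units.val_pow_eq_pow_val, hu]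
    simp)
  exact ⟨k, by rw [← hk]; ring⟩

theorem pow_form (p : ℕ) (k u : ZMod (p ^ 2)) (hu : u = 1 + (p : ZMod (p ^ 2)) * k) (i : ℕ) :
    u ^ i = 1 + (p : ZMod (p ^ 2)) * (k * (i : ZMod (p ^ 2))) := by
  induction i with
  | zero => simp
  | succ i ih =>
    have h1 : u ^ (i + 1) = u ^ i * u := pow_succ u i
    push_cast
    linear_combination h1 + u * ih + (1 + (p : ZMod (p ^ 2)) * (k * i)) * hu + (k * i * k) * psq p

theorem sum_form (p : ℕ) (k u : ZMod (p ^ 2)) (hu : u = 1 + (p : ZMod (p ^ 2)) * k) (m : ℕ) :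
    ∑ i ∈ Finset.range m, u ^ i = (m : ZMod (p ^ 2)) + (p : ZMod (p ^ 2)) *
      (k * ((∑ i ∈ Finset.range m, i : ℕ) : ZMod (p ^ 2))) := by
  simp only [pow_form p k u hu, Finset.sum_add_distrib, ← Finset.mul_sum]
  simp

theorem sum_p (p : ℕ) (hp : p.Prime) (hodd : Odd p) (u : (ZMod (p ^ 2))ˣ) (hu : u ^ p = 1) :
    ∑ i ∈ Finset.range p, (u : ZMod (p ^ 2)) ^ i = p := by
  obtain ⟨k, hk⟩ := unit_form p hp u hu
  rw [sum_form p k u hk]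
  obtain ⟨c, hc⟩ := hodd
  have : ∑ i ∈ Finset.range p, i = p * c := by
    have h := Finset.sum_range_id_mul_two p
    have h2 : p - 1 = c * 2 := by omega
    rw [h2, ← mul_assoc] at h
    exact Nat.eq_of_mul_eq_mul_right (by norm_num) h
  rw [this]; push_cast
  linear_combination (k * c) * psq p

theorem aff_pow_p (p : ℕ) (hp : p.Prime) (hodd : Odd p) (a : ZMod (p ^ 2))
    (u : (ZMod (p ^ 2))ˣ) (hu : u ^ p = 1) (t : ℕ) (x : ZMod (p ^ 2)) :
    (affinePerm (p ^ 2) a u ^ (p * t)) x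
      = a * (p : ZMod (p ^ 2)) * (t : ZMod (p ^ 2)) + x := by
  induction t with
  | zero => simp
  | succ t ih =>
    rw [mul_add, mul_one, add_comm, pow_add, Equiv.Perm.mul_apply, ih, aff_pow, sum_p p hp hodd u hu,
      ← Units.val_pow_eq_pow_val, hu]
    push_cast; ring

theorem p_ne (p : ℕ) (hp : p.Prime) : (p : ZMod (p ^ 2)) ≠ 0 := by
  intro h
  rw [ZMod.natCast_eq_zero_iff] at h
  have := Nat.le_of_dvd hp.pos h
  nlinarith [hp.two_le]

theorem aff_order (p : ℕ) (hp : p.Prime) (hodd : Odd p)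
    (u : (ZMod (p ^ 2))ˣ) (hu : u ^ p = 1) : orderOf (affinePerm (p ^ 2) 1 u) = p ^ 2 := by
  have := Fact.mk hp
  refine orderOf_eq_prime_pow (p := p) (n := 1) ?_ ?_
  · intro h
    have := aff_pow_p p hp hodd 1 u hu 1 0
    rw [pow_one] at h
    rw [mul_one, h] at this
    apply p_ne p hp
    simpa using this.symm
  · ext1 x
    have := aff_pow_p p hp hodd 1 u hu p x
    rw [← pow_two, one_mul, psq, zero_add] at this
    simpa using this

theorem units_card (p : ℕ) (hp : p.Prime) : Nat.card (ZMod (p ^ 2))ˣ = p * (p - 1) := by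
  have : NeZero (p ^ 2) := ⟨pow_ne_zero _ hp.ne_zero⟩
  rw [Nat.card_eq_fintype_card, ZMod.card_units_eq_totient, Nat.totient_prime_pow hp (by norm_num)]
  simp

theorem unit_pow (p : ℕ) (hp : p.Prime) (u : (ZMod (p ^ 2))ˣ) (hu : u ^ (p ^ 2) = 1) :
    u ^ p = 1 := by
  have h1 : orderOf u ∣ p * (p - 1) := units_card p hp ▸ orderOf_dvd_natCard u
  have h2 := orderOf_dvd_of_pow_eq_one hu
  apply orderOf_dvd_iff_pow_eq_one.1
  have h3 := Nat.dvd_gcd h1 h2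
  have : Nat.gcd (p - 1) p = 1 := by
    have h := (Nat.coprime_self_sub_left hp.one_le).2 (by simp)
    exact h
  have h4 : Nat.gcd (p * (p - 1)) (p ^ 2) = p := by
    rw [pow_two, Nat.gcd_mul_left, this, mul_one]
  rwa [h4] at h3

theorem unit_gen (p : ℕ) (hp : p.Prime) (σ : (ZMod (p ^ 2))ˣ) (hσ : orderOf σ = p * (p - 1))
    (v : (ZMod (p ^ 2))ˣ) (hv : v ^ p = 1) : ∃ j < p, v = σ ^ (j * (p - 1)) := by
  have : NeZero (p ^ 2) := ⟨pow_ne_zero _ hp.ne_zero⟩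
  have hz : Subgroup.zpowers σ = ⊤ := by
    apply Subgroup.eq_top_of_card_eq
    rw [Nat.card_zpowers, hσ, units_card p hp]
  have hm : v ∈ Subgroup.zpowers σ := hz ▸ Subgroup.mem_top v
  rw [← mem_powers_iff_mem_zpowers] at hm
  obtain ⟨n, rfl⟩ := hm
  simp only at hv ⊢
  rw [← pow_mul] at hv
  have hd := orderOf_dvd_of_pow_eq_one hv
  rw [hσ, mul_comm] at hd
  obtain ⟨j, rfl⟩ := Nat.dvd_of_mul_dvd_mul_right hp.pos hd
  refine ⟨j % p, Nat.mod_lt _ hp.pos, ?_⟩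
  rw [pow_eq_pow_iff_modEq, hσ, mul_comm (p - 1) j]
  exact Nat.ModEq.mul_right' _ (Nat.mod_modEq j p).symm

theorem gen_pow (p : ℕ) (σ : (ZMod (p ^ 2))ˣ) (hσ : orderOf σ = p * (p - 1)) (j : ℕ) :
    (σ ^ (j * (p - 1))) ^ p = 1 := by
  rw [← pow_mul, ← orderOf_dvd_iff_pow_eq_one, hσ]
  exact ⟨j, by ring⟩

theorem stmt_6 (p : ℕ) (hp : p.Prime) (hodd : Odd p)
    (σ : (ZMod (p ^ 2))ˣ) (hσ : orderOf σ = p * (p - 1)) :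
    (∀ H : Subgroup (Equiv.Perm (ZMod (p ^ 2))),
      ((∀ f ∈ H, ∃ (a : ZMod (p ^ 2)) (u : (ZMod (p ^ 2))ˣ),
          ∀ x, f x = a + (u : ZMod (p ^ 2)) * x) ∧
        IsCyclic H ∧ Nat.card H = p ^ 2) ↔
      (∃ j < p, H = Subgroup.zpowers (affinePerm (p ^ 2) 1 (σ ^ (j * (p - 1)))))) ∧
    ∀ j < p, ∀ j' < p,
      Subgroup.zpowers (affinePerm (p ^ 2) 1 (σ ^ (j * (p - 1)))) =
        Subgroup.zpowers (affinePerm (p ^ 2) 1 (σ ^ (j' * (p - 1)))) → j = j' := by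
  have := Fact.mk hp
  have : NeZero (p ^ 2) := ⟨pow_ne_zero _ hp.ne_zero⟩
  have happ : ∀ (a : ZMod (p ^ 2)) u x, affinePerm (p ^ 2) a u x = a + (u : ZMod (p ^ 2)) * x := fun _ _ _ => rfl
  refine ⟨fun H => ⟨?_, ?_⟩, ?_⟩
  · rintro ⟨haff, hcyc, hcard⟩
    -- exponents
    have hpow : ∀ g ∈ H, g ^ (p ^ 2) = 1 := by
      intro g hg
      have := pow_card_eq_one' (G := H) (x := ⟨g, hg⟩)
      rw [hcard] at this
      simpa using congrArg Subtype.val this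
    have hup : ∀ a u, affinePerm (p ^ 2) a u ∈ H → u ^ p = 1 := by
      intro a u hm
      apply unit_pow p hp
      have h0 := aff_pow _ a u (p ^ 2) 0
      have h1 := aff_pow _ a u (p ^ 2) 1
      rw [hpow _ hm] at h0 h1
      ext
      simp only [Equiv.Perm.one_apply] at h0 h1
      push_cast
      linear_combination h0 - h1
    obtain ⟨⟨f, hf⟩, hgen⟩ := hcyc.exists_generator
    obtain ⟨a, u, hau⟩ := haff f hf
    obtain rfl : f = affinePerm (p ^ 2) a u := Equiv.ext hau
    have hu := hup a u hf
    have hford : orderOf (affinePerm (p ^ 2) a u) = p ^ 2 := by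
      have h := orderOf_eq_card_of_forall_mem_zpowers hgen
      rw [Subgroup.orderOf_mk] at h
      exact h.trans hcard
    obtain ⟨k, hk⟩ := unit_form p hp u hu
    -- a is nonzero mod p
    have ha : ZMod.castHom (Dvd.intro_left p (by ring : p * p = p ^ 2)) (ZMod p) a ≠ 0 := by
      intro h0
      obtain ⟨c, hc⟩ := cast_zero_dvd p hp a h0
      have : affinePerm (p ^ 2) a u ^ p = 1 := by
        ext1 x
        have := aff_pow_p p hp hodd a u hu 1 x
        rw [mul_one] at this
        rw [this, Equiv.Perm.one_apply]
        push_cast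
        linear_combination (p : ZMod (p ^ 2)) * hc + c * psq p
      have := orderOf_dvd_of_pow_eq_one this
      rw [hford] at this
      have := Nat.le_of_dvd hp.pos this
      nlinarith [hp.two_le]
    set φ := ZMod.castHom (Dvd.intro_left p (by ring : p * p = p ^ 2)) (ZMod p) with hφ
    have hφp : φ (p : ZMod (p ^ 2)) = 0 := by simp
    -- step one
    set m := (φ a)⁻¹.val with hm
    have hmφ : ((m : ℕ) : ZMod p) = (φ a)⁻¹ := ZMod.natCast_zmod_val _
    obtain ⟨c, hc⟩ := cast_zero_dvd p hp
      (1 - a * ∑ i ∈ Finset.range m, (u : ZMod (p ^ 2)) ^ i) (by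
        rw [sum_form p k u hk, ← hφ, map_sub, map_one, map_mul, map_add, map_mul, hφp, map_natCast,
          hmφ, zero_mul, add_zero, mul_inv_cancel₀ ha, sub_self])
    obtain ⟨b, hb⟩ := cast_zero_dvd p hp (1 - a * m) (by
        rw [← hφ, map_sub, map_one, map_mul, map_natCast,
          hmφ, mul_inv_cancel₀ ha, sub_self])
    set g := affinePerm (p ^ 2) a u ^ (p * (m * c)) * affinePerm (p ^ 2) a u ^ m with hg
    have hgH : g ∈ H := H.mul_mem (H.pow_mem hf _) (H.pow_mem hf _)
    have hg0 : g 0 = 1 := by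
      rw [hg, Equiv.Perm.mul_apply, aff_pow_p p hp hodd a u hu, aff_pow]
      push_cast
      linear_combination -hc - p * c * hb - c * b * psq p
    obtain ⟨a', v, hv⟩ := haff g hgH
    have ha' : a' = 1 := by rw [← hg0, hv 0]; ring
    subst ha'
    have hgv : g = affinePerm (p ^ 2) 1 v := Equiv.ext hv
    rw [hgv] at hgH
    have hvp := hup _ _ hgH
    obtain ⟨j, hj, rfl⟩ := unit_gen p hp σ hσ v hvp
    refine ⟨j, hj, ?_⟩
    symm
    apply Subgroup.eq_of_le_of_card_ge
    · simpa using hgH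
    · rw [hcard, Nat.card_zpowers, aff_order p hp hodd _ hvp]
  · rintro ⟨j, hj, rfl⟩
    have hv := gen_pow p σ hσ j
    refine ⟨?_, inferInstance, ?_⟩
    · intro f hf
      rw [← mem_powers_iff_mem_zpowers] at hf
      obtain ⟨n, rfl⟩ := hf
      refine ⟨1 * ∑ i ∈ Finset.range n, ((σ ^ (j * (p - 1)) : (ZMod (p ^ 2))ˣ) : ZMod (p ^ 2)) ^ i,
        (σ ^ (j * (p - 1))) ^ n, fun x => ?_⟩
      rw [Units.val_pow_eq_pow_val]
      exact aff_pow _ _ _ _ _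
    · rw [Nat.card_zpowers, aff_order p hp hodd _ hv]
  · intro j hj j' hj' h
    have hv := gen_pow p σ hσ j
    have hmem : affinePerm (p ^ 2) 1 (σ ^ (j' * (p - 1))) ∈
        Subgroup.zpowers (affinePerm (p ^ 2) 1 (σ ^ (j * (p - 1)))) :=
      h ▸ Subgroup.mem_zpowers _
    rw [← mem_powers_iff_mem_zpowers] at hmem
    obtain ⟨m, hm⟩ := hmem
    simp only at hm
    obtain ⟨k, hk⟩ := unit_form p hp _ hv
    have h0 := aff_pow _ 1 (σ ^ (j * (p - 1))) m 0
    have h1 := aff_pow _ 1 (σ ^ (j * (p - 1))) m 1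
    rw [hm, happ] at h0 h1
    have hm1 : m ≡ 1 [MOD p] := by
      rw [sum_form p k _ hk] at h0
      rw [← ZMod.natCast_eq_natCast_iff]
      have := congrArg (ZMod.castHom (Dvd.intro_left p (by ring : p * p = p ^ 2)) (ZMod p)) h0
      simpa using this.symm
    have e1 : σ ^ (j' * (p - 1)) = (σ ^ (j * (p - 1))) ^ m := by
      apply Units.ext
      rw [Units.val_pow_eq_pow_val (σ ^ (j * (p - 1))) m]
      linear_combination h1 - h0
    have e2 : (σ ^ (j * (p - 1))) ^ m = σ ^ (j * (p - 1)) := by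
      conv_rhs => rw [← pow_one (σ ^ (j * (p - 1)))]
      rw [pow_eq_pow_iff_modEq]
      exact hm1.of_dvd (orderOf_dvd_of_pow_eq_one hv)
    have hp1 : 0 < p - 1 := Nat.sub_pos_of_lt hp.one_lt
    have := pow_injOn_Iio_orderOf (x := σ)
      (by rw [Set.mem_Iio, hσ]; exact Nat.mul_lt_mul_of_pos_right hj' hp1)
      (by rw [Set.mem_Iio, hσ]; exact Nat.mul_lt_mul_of_pos_right hj hp1) (e1.trans e2)
    exact (Nat.eq_of_mul_eq_mul_right hp1 this).symm
end

section
/- Let p be an odd prime. Every transitive subgroup of Hol(C_{2p}) = ⟨a, b | a^{2p} = 1, b^{p−1} = 1, bab⁻¹ = a^i⟩ acting naturally on ℤ/2pℤ contains the element a². Moreover, any transitive subgroup either contains a, or is of the form ⟨a², ab^{(p−1)/(2m)}⟩ ≅ C_p ⋊ C_{2m} for some m with 2m an even divisor of p−1. -/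
namespace Stmt17

theorem cyc {G : Type*} [Group G] [Finite G] (i : G) (n : ℕ) (hn : 0 < n) (hi : orderOf i = n)
    (htop : ∀ x, x ∈ Subgroup.zpowers i) (K : Subgroup G) (hd : Nat.card K ∣ n) :
    orderOf (i ^ (n / Nat.card K)) = Nat.card K ∧
    K = Subgroup.zpowers (i ^ (n / Nat.card K)) := by
  obtain ⟨e, he⟩ := hd
  have hdpos : 0 < Nat.card K := Nat.card_pos
  have hdiv : n / Nat.card K = e := by rw [he]; exact Nat.mul_div_cancel_left _ hdpos
  rw [hdiv]
  have hepos : 0 < e := by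
    rcases Nat.eq_zero_or_pos e with h | h
    · subst h; omega
    · exact h
  have hord : orderOf (i ^ e) = Nat.card K := by
    rw [orderOf_pow_of_dvd hepos.ne' (by rw [hi, he]; exact Dvd.intro_left _ rfl), hi, he]
    exact Nat.mul_div_cancel _ hepos
  refine ⟨hord, ?_⟩
  apply Subgroup.eq_of_le_of_card_ge
  · intro x hx
    obtain ⟨k, rfl⟩ := (mem_powers_iff_mem_zpowers).2 (htop x)
    have h1 : (i ^ k) ^ Nat.card K = 1 := by
      have := pow_card_eq_one' (x := (⟨i ^ k, hx⟩ : K))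
      exact congrArg Subtype.val this
    rw [← pow_mul, ← orderOf_dvd_iff_pow_eq_one, hi, he, mul_comm k] at h1
    obtain ⟨c, rfl⟩ := Nat.dvd_of_mul_dvd_mul_left hdpos h1
    refine ⟨c, ?_⟩
    simp [pow_mul]
  · rw [Nat.card_zpowers, hord]

theorem P_apply (n : ℕ) (a : ZMod n) (u : (ZMod n)ˣ) (x : ZMod n) :
    affinePerm n a u x = a + u * x := rfl

theorem P_mul (n : ℕ) (a b : ZMod n) (u v : (ZMod n)ˣ) :
    affinePerm n a u * affinePerm n b v = affinePerm n (a + u * b) (u * v) := by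
  ext x; simp only [Equiv.Perm.mul_apply, P_apply, Units.val_mul]; rw [mul_add, mul_assoc, add_assoc]

theorem P_one (n : ℕ) : affinePerm n 0 1 = 1 := by
  ext x; simp [P_apply]

theorem P_inj {n : ℕ} {a b : ZMod n} {u v : (ZMod n)ˣ} (h : affinePerm n a u = affinePerm n b v) :
    a = b ∧ u = v := by
  have h0 := congrArg (fun f => f 0) h
  have h1 := congrArg (fun f => f 1) h
  simp only [P_apply, mul_zero, add_zero, mul_one] at h0 h1
  subst h0
  exact ⟨rfl, Units.ext (add_left_cancel h1)⟩

theorem P_inv (n : ℕ) (a : ZMod n) (u : (ZMod n)ˣ) :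
    (affinePerm n a u)⁻¹ = affinePerm n (-((u⁻¹ : (ZMod n)ˣ) * a)) u⁻¹ := by
  rw [inv_eq_iff_mul_eq_one, P_mul, ← P_one]; simp

theorem P_mul_inv (n : ℕ) (a b : ZMod n) (u : (ZMod n)ˣ) :
    affinePerm n a u * (affinePerm n b u)⁻¹ = affinePerm n (a - b) 1 := by
  rw [mul_inv_eq_iff_eq_mul, P_mul]; simp

theorem P_pow_one (n : ℕ) (a : ZMod n) (k : ℕ) :
    (affinePerm n a 1) ^ k = affinePerm n (k * a) 1 := by
  induction k with
  | zero => simp [P_one]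
  | succ k ih => rw [pow_succ, ih, P_mul]; simp; congr 1; ring

theorem P_pow_zero (n : ℕ) (u : (ZMod n)ˣ) (k : ℕ) :
    (affinePerm n 0 u) ^ k = affinePerm n 0 (u ^ k) := by
  induction k with
  | zero => simp [P_one]
  | succ k ih => rw [pow_succ, ih, P_mul]; simp [pow_succ]

theorem P_pow_lin (n : ℕ) (a : ZMod n) (u : (ZMod n)ˣ) (k : ℕ) :
    ∃ c, (affinePerm n a u) ^ k = affinePerm n c (u ^ k) := by
  induction k with
  | zero => exact ⟨0, by simp [P_one]⟩
  | succ k ih =>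
    obtain ⟨c, hc⟩ := ih
    exact ⟨_, by rw [pow_succ, hc, P_mul, pow_succ]⟩

theorem even_or (p : ℕ) (hp : 0 < p) (hodd : Odd p) (x : ZMod (2 * p)) :
    (∃ k : ℕ, x = k * 2) ∨ (∃ k : ℕ, x = k * 2 + p) := by
  have : NeZero (2 * p) := ⟨by omega⟩
  rcases Nat.even_or_odd' x.val with ⟨c, h | h⟩
  · left; refine ⟨c, ?_⟩
    rw [← ZMod.natCast_zmod_val x, h]; push_cast; ring
  · right
    obtain ⟨q, hq⟩ := hodd
    refine ⟨c + p - q, ?_⟩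
    have : (((c + p - q) * 2 + p : ℕ) : ZMod (2 * p)) = ((x.val + 2 * p : ℕ) : ZMod (2*p)) := by
      congr 1; omega
    rw [Nat.cast_add x.val, ZMod.natCast_self, ZMod.natCast_zmod_val, add_zero] at this
    rw [← this]; push_cast; ring

theorem two_p (p : ℕ) : (2 * p : ZMod (2 * p)) = 0 := by
  have := ZMod.natCast_self (2 * p)
  push_cast at this; exact this

theorem unit_mul_p (p : ℕ) (hp : 0 < p) (hodd : Odd p) (u : (ZMod (2 * p))ˣ) :
    (u : ZMod (2 * p)) * p = p := by
  obtain ⟨q, hq⟩ := hodd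
  rcases even_or p hp ⟨q, hq⟩ u with ⟨k, hk⟩ | ⟨k, hk⟩
  · exfalso
    have h1 : (u : ZMod (2 * p)) * p = 0 := by rw [hk, mul_assoc, two_p, mul_zero]
    have h2 : (p : ZMod (2 * p)) = 0 := by simpa using h1
    rw [ZMod.natCast_eq_zero_iff] at h2
    have := Nat.le_of_dvd hp h2
    omega
  · have h3 : (p : ZMod (2 * p)) = q * 2 + 1 := by
      have := congrArg (fun t : ℕ => (t : ZMod (2 * p))) hq
      simp only [Nat.cast_add, Nat.cast_mul, Nat.cast_one, Nat.cast_ofNat] at this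
      rw [this]; ring
    rw [hk]
    have : (k * 2 + p : ZMod (2 * p)) * p = k * (2 * p) + p * p := by ring
    rw [this, two_p, mul_zero, zero_add]
    nth_rewrite 1 [h3]
    have : (q * 2 + 1 : ZMod (2 * p)) * p = q * (2 * p) + p := by ring
    rw [this, two_p, mul_zero, zero_add]

theorem P_pow_p (p : ℕ) (hp : 0 < p) (hodd : Odd p) (u : (ZMod (2 * p))ˣ) (k : ℕ) :
    (affinePerm (2 * p) p u) ^ k = affinePerm (2 * p) (k * p) (u ^ k) := by
  induction k with
  | zero => simp [P_one]
  | succ k ih =>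
    rw [pow_succ, ih, P_mul, unit_mul_p p hp hodd, pow_succ]; congr 1; push_cast; ring

theorem card_un (p : ℕ) (hp : p.Prime) (hodd : Odd p) : Nat.card (ZMod (2 * p))ˣ = p - 1 := by
  have : NeZero (2 * p) := ⟨by have := hp.pos; omega⟩
  rw [Nat.card_eq_fintype_card, ZMod.card_units_eq_totient,
    Nat.totient_mul (by simpa using hodd), Nat.totient_prime hp]
  simp

theorem step1 (p : ℕ) (hp : p.Prime) (hodd : Odd p)
    (H : Subgroup (Equiv.Perm (ZMod (2 * p))))
    (haff : ∀ f ∈ H, ∃ a u, f = affinePerm (2 * p) a u)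
    (htrans : ∀ x y : ZMod (2 * p), ∃ f ∈ H, f x = y) :
    affinePerm (2 * p) 2 1 ∈ H := by
  have : NeZero (2 * p) := ⟨by have := hp.pos; omega⟩
  have : Fact p.Prime := ⟨hp⟩
  have : MulAction.IsPretransitive H (ZMod (2 * p)) :=
    ⟨fun x y => by obtain ⟨f, hf, h⟩ := htrans x y; exact ⟨⟨f, hf⟩, h⟩⟩
  have h1 := MulAction.index_stabilizer_of_transitive H (0 : ZMod (2 * p))
  have h2 : p ∣ Nat.card H := by
    refine dvd_trans ?_ (Subgroup.index_dvd_card (MulAction.stabilizer H (0 : ZMod (2 * p))))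
    rw [h1, Nat.card_zmod]; exact Dvd.intro_left _ rfl
  obtain ⟨⟨f, hf⟩, hford⟩ := exists_prime_orderOf_dvd_card' p h2
  rw [Subgroup.orderOf_mk] at hford
  obtain ⟨a, u, rfl⟩ := haff f hf
  have hpow : affinePerm (2 * p) a u ^ p = 1 := orderOf_dvd_iff_pow_eq_one.1 (dvd_of_eq hford)
  have hu : u = 1 := by
    obtain ⟨c, hc⟩ := P_pow_lin (2 * p) a u p
    rw [hpow, ← P_one] at hc
    have h3 := (P_inj hc).2
    have h4 : u ^ (p - 1) = 1 := by rw [← card_un p hp hodd]; exact pow_card_eq_one'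
    have : u ^ p = u ^ (p - 1) * u := by rw [← pow_succ]; congr 1; have := hp.pos; omega
    rw [h4, one_mul, ← h3] at this
    exact this.symm
  subst hu
  rw [P_pow_one, ← P_one] at hpow
  have h5 := (P_inj hpow).1
  have ha0 : a ≠ 0 := by
    rintro rfl
    rw [P_one, orderOf_one] at hford
    exact hp.one_lt.ne hford
  rcases even_or p hp.pos hodd a with ⟨k, hk⟩ | ⟨k, hk⟩
  · have hkp : ¬ p ∣ k := by
      rintro ⟨c, rfl⟩
      apply ha0
      rw [hk]; push_cast
      have : (p * c * 2 : ZMod (2 * p)) = c * (2 * p) := by ring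
      rw [this, two_p, mul_zero]
    have hcop : Nat.Coprime k p := ((Nat.Prime.coprime_iff_not_dvd hp).2 hkp).symm
    obtain ⟨n, hn⟩ := Nat.exists_mul_mod_eq_one_of_coprime hcop hp.one_lt
    have key : (affinePerm (2 * p) a 1) ^ n = affinePerm (2 * p) 2 1 := by
      rw [P_pow_one]; congr 1
      rw [hk]
      have h7 : k * n = p * (k * n / p) + 1 := by have := Nat.div_add_mod (k * n) p; rw [hn.2] at this; exact this.symm
      have h8 := congrArg (fun t : ℕ => (t : ZMod (2 * p))) h7
      simp only [Nat.cast_add, Nat.cast_mul, Nat.cast_one] at h8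
      have : (n * (k * 2) : ZMod (2 * p)) = (k * n) * 2 := by ring
      rw [this, h8]
      generalize ((k * n / p : ℕ) : ZMod (2 * p)) = c
      have : ((p * c + 1) * 2 : ZMod (2 * p)) = c * (2 * p) + 2 := by ring
      rw [this, two_p, mul_zero, zero_add]
    rw [← key]; exact H.pow_mem hf n
  · exfalso
    rw [hk] at h5
    have h6 : (p * (k * 2 + p) : ZMod (2 * p)) = k * (2 * p) + p * p := by ring
    rw [h6, two_p, mul_zero, zero_add, ← Nat.cast_mul, ZMod.natCast_eq_zero_iff] at h5
    have h7 : 2 ∣ p * p := dvd_trans (Dvd.intro _ rfl) h5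
    have h8 : Odd (p * p) := hodd.mul hodd
    exact (Nat.not_even_iff_odd.2 h8) (even_iff_two_dvd.2 h7)

theorem shift {n : ℕ} {H : Subgroup (Equiv.Perm (ZMod n))} (h2 : affinePerm n 2 1 ∈ H)
    (k : ℕ) (a : ZMod n) (u : (ZMod n)ˣ) :
    affinePerm n (k * 2 + a) u ∈ H ↔ affinePerm n a u ∈ H := by
  have h : affinePerm n (k * 2 + a) u = affinePerm n 2 1 ^ k * affinePerm n a u := by
    rw [P_pow_one, P_mul]; simp
  rw [h]
  exact H.mul_mem_cancel_left (H.pow_mem h2 k)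

theorem iso (p : ℕ) (hp : p.Prime) (hodd : Odd p) (d : ℕ) (hd : d ∣ p - 1) (hd2 : 2 ∣ d)
    (g : (ZMod (2 * p))ˣ) (hg : orderOf g = d)
    (H : Subgroup (Equiv.Perm (ZMod (2 * p))))
    (haff : ∀ f ∈ H, ∃ a u, f = affinePerm (2 * p) a u)
    (h2 : affinePerm (2 * p) 2 1 ∈ H) (ht : affinePerm (2 * p) p g ∈ H)
    (hdec : ∀ f ∈ H, ∃ j k : ℕ, f = affinePerm (2 * p) 2 1 ^ j * affinePerm (2 * p) p g ^ k) :
    ∃ φ : Multiplicative (ZMod d) →* MulAut (Multiplicative (ZMod p)),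
          Nonempty (H ≃* Multiplicative (ZMod p) ⋊[φ] Multiplicative (ZMod d)) := by
  have : NeZero (2 * p) := ⟨by have := hp.pos; omega⟩
  have : Fact p.Prime := ⟨hp⟩
  set A : H := ⟨_, h2⟩ with hA
  set T : H := ⟨_, ht⟩ with hT
  have oA : orderOf A = p := by
    rw [hA, Subgroup.orderOf_mk]
    apply orderOf_eq_prime
    · rw [P_pow_one, ← P_one, mul_comm (p : ZMod (2 * p)), two_p]
    · intro h
      rw [← P_one] at h
      have := (P_inj h).1
      have h' : ((2 : ℕ) : ZMod (2 * p)) = 0 := by exact_mod_cast this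
      rw [ZMod.natCast_eq_zero_iff] at h'
      have := Nat.le_of_dvd (by norm_num) h'
      have := hp.one_lt
      omega
  have oT : orderOf T = d := by
    rw [hT, Subgroup.orderOf_mk]
    apply Nat.dvd_antisymm
    · rw [orderOf_dvd_iff_pow_eq_one, P_pow_p p hp.pos hodd, ← P_one, ← hg, pow_orderOf_eq_one, hg]
      congr 1
      obtain ⟨e, rfl⟩ := hd2
      have : (((2 * e : ℕ) : ZMod (2 * p)) * p) = e * (2 * p) := by push_cast; ring
      rw [this, two_p, mul_zero]
    · have := pow_orderOf_eq_one (affinePerm (2 * p) p g)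
      rw [P_pow_p p hp.pos hodd, ← P_one] at this
      rw [← hg]
      exact orderOf_dvd_of_pow_eq_one (P_inj this).2
  have cA : Nat.card (Subgroup.zpowers A) = p := by rw [Nat.card_zpowers, oA]
  have cT : Nat.card (Subgroup.zpowers T) = d := by rw [Nat.card_zpowers, oT]
  have hN : (Subgroup.zpowers A).Normal := by
    have key : ∀ f : H, f * A * f⁻¹ ∈ Subgroup.zpowers A := by
      rintro ⟨f, hf⟩
      obtain ⟨a, u, rfl⟩ := haff f hf
      refine ⟨((u : ZMod (2 * p)).val : ℤ), ?_⟩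
      apply Subtype.ext
      simp only [hA, zpow_natCast, Subgroup.coe_pow, Subgroup.coe_mul, Subgroup.coe_inv]
      rw [P_pow_one, P_inv, P_mul, P_mul]
      simp
    constructor
    rintro _ ⟨k, rfl⟩ f
    have : f * A ^ k * f⁻¹ = (f * A * f⁻¹) ^ k := by rw [conj_zpow]
    simp only
    rw [this]
    exact Subgroup.zpow_mem _ (key f) k
  have hcomp : (Subgroup.zpowers A).IsComplement' (Subgroup.zpowers T) := by
    apply Subgroup.isComplement'_of_disjoint_and_mul_eq_univ
    · apply Subgroup.disjoint_of_coprime_natCard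
      rw [cA, cT]
      refine Nat.Coprime.coprime_dvd_right hd ?_
      refine (Nat.Prime.coprime_iff_not_dvd hp).2 fun h => ?_
      have := hp.one_lt
      have := Nat.le_of_dvd (by omega) h
      omega
    · rw [Set.eq_univ_iff_forall]
      rintro ⟨f, hf⟩
      obtain ⟨j, k, hjk⟩ := hdec f hf
      refine ⟨A ^ j, ⟨j, by simp⟩, T ^ k, ⟨k, by simp⟩, ?_⟩
      apply Subtype.ext
      simp [hA, hT, hjk]
  have e1 : Multiplicative (ZMod p) ≃* Subgroup.zpowers A := by
    have := zmodCyclicMulEquiv (G := Subgroup.zpowers A) inferInstance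
    rwa [cA] at this
  have e2 : Multiplicative (ZMod d) ≃* Subgroup.zpowers T := by
    have := zmodCyclicMulEquiv (G := Subgroup.zpowers T) inferInstance
    rwa [cT] at this
  exact ⟨_, ⟨(SemidirectProduct.mulEquivSubgroup hcomp).symm.trans
    (SemidirectProduct.congr' e1.symm e2.symm)⟩⟩

end Stmt17

open Stmt17 in
theorem stmt_17 (p : ℕ) (hp : p.Prime) (hodd : Odd p)
    (i : (ZMod (2 * p))ˣ) (hi : orderOf i = p - 1)
    (H : Subgroup (Equiv.Perm (ZMod (2 * p))))
    (haff : ∀ f ∈ H, ∃ (a : ZMod (2 * p)) (u : (ZMod (2 * p))ˣ),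
      ∀ x, f x = a + (u : ZMod (2 * p)) * x)
    (htrans : ∀ x y : ZMod (2 * p), ∃ f ∈ H, f x = y) :
    (affinePerm (2 * p) 1 1) ^ 2 ∈ H ∧
    (affinePerm (2 * p) 1 1 ∈ H ∨
      ∃ m : ℕ, 0 < m ∧ 2 * m ∣ p - 1 ∧
        H = Subgroup.closure {(affinePerm (2 * p) 1 1) ^ 2,
          affinePerm (2 * p) 1 1 * (affinePerm (2 * p) 0 i) ^ ((p - 1) / (2 * m))} ∧
        ∃ φ : Multiplicative (ZMod (2 * m)) →* MulAut (Multiplicative (ZMod p)),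
          Nonempty (H ≃* Multiplicative (ZMod p) ⋊[φ] Multiplicative (ZMod (2 * m)))) := by
  have : NeZero (2 * p) := ⟨by have := hp.pos; omega⟩
  replace haff : ∀ f ∈ H, ∃ a u, f = affinePerm (2 * p) a u := by
    intro f hf
    obtain ⟨a, u, h⟩ := haff f hf
    exact ⟨a, u, Equiv.ext h⟩
  have h2 := step1 p hp hodd H haff htrans
  have hsq : affinePerm (2 * p) 1 1 ^ 2 = affinePerm (2 * p) 2 1 := by rw [P_pow_one]; simp
  rw [hsq]
  refine ⟨h2, ?_⟩
  by_cases h1 : affinePerm (2 * p) 1 1 ∈ H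
  · exact Or.inl h1
  right
  obtain ⟨q, hq⟩ := id hodd
  have hpq : (p : ZMod (2 * p)) = q * 2 + 1 := by
    have := congrArg (fun t : ℕ => (t : ZMod (2 * p))) hq
    simp only [Nat.cast_add, Nat.cast_mul, Nat.cast_one, Nat.cast_ofNat] at this
    rw [this]; ring
  have h1p : affinePerm (2 * p) p 1 ∉ H := by
    rw [hpq, shift h2]; exact h1
  have hpp : (p + p : ZMod (2 * p)) = 0 := by rw [← two_mul]; exact two_p p
  let K : Subgroup (ZMod (2 * p))ˣ :=
    { carrier := {u | ∃ a, affinePerm (2 * p) a u ∈ H}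
      mul_mem' := by
        rintro u v ⟨a, ha⟩ ⟨b, hb⟩
        exact ⟨_, by rw [← P_mul]; exact H.mul_mem ha hb⟩
      one_mem' := ⟨0, by rw [P_one]; exact H.one_mem⟩
      inv_mem' := by
        rintro u ⟨a, ha⟩
        exact ⟨_, by rw [← P_inv]; exact H.inv_mem ha⟩ }
  have hcard := card_un p hp hodd
  have hp1 : 0 < p - 1 := by have := hp.one_lt; omega
  have hdK : Nat.card K ∣ p - 1 := hcard ▸ Subgroup.card_subgroup_dvd_card K
  have htop : ∀ x, x ∈ Subgroup.zpowers i := by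
    have : Subgroup.zpowers i = ⊤ := by
      apply Subgroup.eq_top_of_card_eq
      rw [Nat.card_zpowers, hi, hcard]
    intro x; rw [this]; trivial
  obtain ⟨hord, hKz⟩ := cyc i (p - 1) hp1 hi htop K hdK
  have hdpos : 0 < Nat.card K := Nat.card_pos
  generalize hd : Nat.card K = d at *
  set g := i ^ ((p - 1) / d) with hgdef
  have mem_or : ∀ a u, affinePerm (2 * p) a u ∈ H →
      affinePerm (2 * p) 0 u ∈ H ∨ affinePerm (2 * p) p u ∈ H := by
    intro a u h
    rcases even_or p hp.pos hodd a with ⟨k, rfl⟩ | ⟨k, rfl⟩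
    · left; rwa [← add_zero ((k : ZMod (2 * p)) * 2), shift h2] at h
    · right; rwa [shift h2] at h
  have not_both : ∀ u, affinePerm (2 * p) 0 u ∈ H → affinePerm (2 * p) p u ∈ H → False := by
    intro u h h'
    apply h1p
    have := H.mul_mem h' (H.inv_mem h)
    rw [P_inv, P_mul] at this
    simpa using this
  have hgK : g ∈ K := by rw [hKz]; exact Subgroup.mem_zpowers g
  have ht : affinePerm (2 * p) p g ∈ H := by
    obtain ⟨a, ha⟩ := hgK
    rcases mem_or a g ha with h | h
    · exfalso
      obtain ⟨f, hf, hfp⟩ := htrans 0 p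
      obtain ⟨b, u, rfl⟩ := haff f hf
      have hb : b = p := by simpa [P_apply] using hfp
      subst hb
      have huK : u ∈ K := ⟨_, hf⟩
      rw [hKz] at huK
      obtain ⟨k, rfl⟩ := (mem_powers_iff_mem_zpowers).2 huK
      refine not_both _ ?_ hf
      simp only
      rw [← P_pow_zero]
      exact H.pow_mem h k
    · exact h
  have hd2 : 2 ∣ d := by
    by_contra hne
    have hoddd : Odd d := by
      rw [← Nat.not_even_iff_odd, even_iff_two_dvd]; exact hne
    obtain ⟨e, he⟩ := hoddd
    have h := H.pow_mem ht d
    rw [P_pow_p p hp.pos hodd, ← hord, pow_orderOf_eq_one, hord, he] at h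
    apply h1p
    have h9 : (((2 * e + 1 : ℕ) : ZMod (2 * p)) * p) = e * (2 * p) + p := by push_cast; ring
    rwa [h9, two_p, mul_zero, zero_add] at h
  have hdec : ∀ f ∈ H, ∃ j k : ℕ,
      f = affinePerm (2 * p) 2 1 ^ j * affinePerm (2 * p) p g ^ k := by
    intro f hf
    obtain ⟨a, u, rfl⟩ := haff f hf
    have huK : u ∈ K := ⟨_, hf⟩
    rw [hKz] at huK
    obtain ⟨k, rfl⟩ := (mem_powers_iff_mem_zpowers).2 huK
    simp only at *
    have hk := H.pow_mem ht k
    rw [P_pow_p p hp.pos hodd] at hk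
    rcases even_or p hp.pos hodd (a - k * p) with ⟨j, hj⟩ | ⟨j, hj⟩
    · refine ⟨j, k, ?_⟩
      rw [P_pow_one, P_pow_p p hp.pos hodd, P_mul, ← hj]
      simp
    · exfalso
      apply h1p
      rw [← shift h2 j, ← hj]
      have := H.mul_mem hf (H.inv_mem hk)
      rw [P_mul_inv] at this
      exact this
  obtain ⟨m, rfl⟩ := hd2
  refine ⟨m, by omega, hdK, ?_, iso p hp hodd (2 * m) hdK (Dvd.intro _ rfl) g hord H haff h2 ht hdec⟩
  have hgen : affinePerm (2 * p) 1 1 * (affinePerm (2 * p) 0 i) ^ ((p - 1) / (2 * m))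
      = affinePerm (2 * p) 1 g := by
    rw [P_pow_zero, P_mul, ← hgdef]; simp
  rw [hgen]
  set C := Subgroup.closure {affinePerm (2 * p) 2 1, affinePerm (2 * p) 1 g} with hC
  have c2 : affinePerm (2 * p) 2 1 ∈ C := Subgroup.subset_closure (by simp)
  have c1 : affinePerm (2 * p) 1 g ∈ C := Subgroup.subset_closure (by simp)
  apply le_antisymm
  · intro f hf
    obtain ⟨j, k, rfl⟩ := hdec f hf
    refine C.mul_mem (C.pow_mem c2 j) (C.pow_mem ?_ k)
    rw [hpq, shift c2]; exact c1
  · rw [hC, Subgroup.closure_le]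
    rintro f (rfl | rfl)
    · exact h2
    · rw [hpq, shift h2] at ht; exact ht
end
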